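/- Sequential partition and extension: let d ≥ 2 and m > 1, let Π_1, …, Π_m be pairwise disjoint distance-d partition systems for Z_n (each with a fixed choice function) with hd(M^i, M^j) ≥ d−1 for all 1 ≤ i < j ≤ m. Suppose further that 𝕡 and 𝕢 are ordered partitions of Z_{n+1} such that Ψ = ((ext(Π_1), ext(Π_2), …, ext(Π_m)), 𝕡, 𝕢) is a distance-d partition system for Z_{n+1} (with ext(Π_m) in the role of the last, unpartitioned set), with some fixed choice function. Then ext(Ψ) is a set of permutations of Z_{n+2} with hd(ext(Ψ)) ≥ d. -/

import Mathlib

/-- Extend a permutation of `Fin n` to a permutation of `Fin (n+1)` fixing the new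
last element `n`. -/
def extFix {n : ℕ} (σ : Equiv.Perm (Fin n)) : Equiv.Perm (Fin (n + 1)) :=
  σ.viaFintypeEmbedding ⟨Fin.castSucc, Fin.castSucc_injective n⟩

/-- The extension `ext_k(σ)` of a permutation `σ` of `Z_n` by position `k`:
it sends `k ↦ n`, `n ↦ σ k`, and `j ↦ σ j` for every other `j < n`. -/
def extPerm {n : ℕ} (σ : Equiv.Perm (Fin n)) (k : Fin n) : Equiv.Perm (Fin (n + 1)) :=
  Equiv.swap (Fin.castSucc (σ k)) (Fin.last n) * extFix σ

/-- A distance-`d` partition system for `Z_n`, together with a fixed choice function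
designating a covering position for each covered permutation. -/
structure PartitionSystem (n s d : ℕ) where
  /-- the list `M_1, …, M_{s+1}` of pairwise disjoint sets of permutations -/
  M : Fin (s + 1) → Finset (Equiv.Perm (Fin n))
  /-- the ordered partition of positions `P_1, …, P_s` -/
  P : Fin s → Finset (Fin n)
  /-- the ordered partition of symbols `Q_1, …, Q_s` -/
  Q : Fin s → Finset (Fin n)
  M_disjoint : ∀ i j, i ≠ j → Disjoint (M i) (M j)
  P_disjoint : ∀ i j, i ≠ j → Disjoint (P i) (P j)
  P_cover : ∀ x : Fin n, ∃ i, x ∈ P i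
  Q_disjoint : ∀ i j, i ≠ j → Disjoint (Q i) (Q j)
  Q_cover : ∀ x : Fin n, ∃ i, x ∈ Q i
  /-- Property (I): `hd(M_i) ≥ d` -/
  hd_intra : ∀ i, ∀ σ ∈ M i, ∀ τ ∈ M i, σ ≠ τ → d ≤ hammingDist ⇑σ ⇑τ
  /-- Property (II): `hd(M_i, M_j) ≥ d − 1` for `i ≠ j` -/
  hd_inter : ∀ i j, i ≠ j → ∀ σ ∈ M i, ∀ τ ∈ M j, d - 1 ≤ hammingDist ⇑σ ⇑τ
  /-- the choice function designating a covering position for each covered permutation -/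
  choice : Fin s → Equiv.Perm (Fin n) → Fin n
  choice_spec : ∀ i σ, (∃ p ∈ P i, σ p ∈ Q i) →
    choice i σ ∈ P i ∧ σ (choice i σ) ∈ Q i

/-- The extended array `ext(Π)`: all `ext_{p_σ}(σ)` for covered `σ ∈ M_i` (`1 ≤ i ≤ s`),
together with the extensions of all `σ ∈ M_{s+1}` by the fixed point `n ↦ n`. -/
def extSet {n s d : ℕ} (Ps : PartitionSystem n s d) :
    Finset (Equiv.Perm (Fin (n + 1))) :=
  ((Finset.univ : Finset (Fin s)).biUnion fun i =>
    ((Ps.M i.castSucc).filter fun σ => ∃ p ∈ Ps.P i, σ p ∈ Ps.Q i).image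
      fun σ => extPerm σ (Ps.choice i σ))
  ∪ (Ps.M (Fin.last s)).image extFix

theorem extFix_castSucc {n : ℕ} (σ : Equiv.Perm (Fin n)) (x : Fin n) :
    extFix σ x.castSucc = (σ x).castSucc :=
  Equiv.Perm.viaFintypeEmbedding_apply_image (e := σ)
    (f := ⟨Fin.castSucc, Fin.castSucc_injective n⟩) x

theorem extFix_last {n : ℕ} (σ : Equiv.Perm (Fin n)) :
    extFix σ (Fin.last n) = Fin.last n := by
  refine Equiv.Perm.viaFintypeEmbedding_apply_notMem_range _ _ ?_
  rintro ⟨x, hx⟩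
  exact Fin.castSucc_ne_last x hx

theorem extPerm_castSucc {n : ℕ} (σ : Equiv.Perm (Fin n)) (k x : Fin n) :
    extPerm σ k x.castSucc = if x = k then Fin.last n else (σ x).castSucc := by
  rw [extPerm, Equiv.Perm.mul_apply, extFix_castSucc]
  split_ifs with h
  · rw [h, Equiv.swap_apply_left]
  · refine Equiv.swap_apply_of_ne_of_ne (fun e => h ?_) (Fin.castSucc_ne_last _)
    exact σ.injective (Fin.castSucc_injective n e)

theorem extPerm_last {n : ℕ} (σ : Equiv.Perm (Fin n)) (k : Fin n) :
    extPerm σ k (Fin.last n) = (σ k).castSucc := by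
  rw [extPerm, Equiv.Perm.mul_apply, extFix_last, Equiv.swap_apply_right]

theorem hammingDist_castSucc_add {n : ℕ} {α : Type*} [DecidableEq α] (f g : Fin (n + 1) → α) :
    hammingDist f g = hammingDist (fun x : Fin n => f x.castSucc) (fun x => g x.castSucc) +
      if f (Fin.last n) ≠ g (Fin.last n) then 1 else 0 := by
  simp only [hammingDist, Finset.card_filter, Fin.sum_univ_castSucc]

theorem hammingDist_extFix {n : ℕ} (σ τ : Equiv.Perm (Fin n)) :
    hammingDist ⇑(extFix σ) ⇑(extFix τ) = hammingDist ⇑σ ⇑τ := by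
  rw [hammingDist_castSucc_add]
  simp [extFix_castSucc, extFix_last, hammingDist]

theorem hammingDist_le_extPerm {n : ℕ} (σ τ : Equiv.Perm (Fin n)) (p q : Fin n) :
    hammingDist ⇑σ ⇑τ ≤ hammingDist ⇑(extPerm σ p) ⇑(extPerm τ q) := by
  rw [hammingDist_castSucc_add]
  simp only [extPerm_castSucc, extPerm_last]
  by_cases h : p = q ∧ σ p ≠ τ q
  · obtain ⟨rfl, h⟩ := h
    rw [if_pos fun e => h (Fin.castSucc_injective n e)]
    refine le_trans (Finset.card_le_card ?_) (Finset.card_insert_le p _)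
    intro x hx
    simp only [Finset.mem_filter, Finset.mem_univ, true_and, Finset.mem_insert] at hx ⊢
    by_cases hp : x = p
    · exact Or.inl hp
    · right
      simpa [hp] using hx
  · refine le_trans (Finset.card_le_card ?_) (Nat.le_add_right _ _)
    intro x hx
    simp only [Finset.mem_filter, Finset.mem_univ, true_and] at hx ⊢
    have h₁ := Fin.castSucc_ne_last (σ x)
    have h₂ := Fin.castSucc_ne_last (τ x)
    have h₃ := Fin.castSucc_injective n (a₁ := σ x) (a₂ := τ x)
    grind

theorem hammingDist_lt_extPerm {n : ℕ} (σ τ : Equiv.Perm (Fin n)) {p q : Fin n}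
    (hpq : p ≠ q) (h : σ p ≠ τ q) :
    hammingDist ⇑σ ⇑τ < hammingDist ⇑(extPerm σ p) ⇑(extPerm τ q) := by
  rw [hammingDist_castSucc_add]
  simp only [extPerm_castSucc, extPerm_last]
  rw [if_pos fun e => h (Fin.castSucc_injective n e), Nat.lt_add_one_iff]
  refine Finset.card_le_card ?_
  intro x hx
  simp only [Finset.mem_filter, Finset.mem_univ, true_and] at hx ⊢
  have h₁ := Fin.castSucc_ne_last (σ x)
  have h₂ := Fin.castSucc_ne_last (τ x)
  have h₃ := Fin.castSucc_injective n (a₁ := σ x) (a₂ := τ x)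
  grind

theorem hammingDist_lt_extPerm_extFix {n : ℕ} (σ τ : Equiv.Perm (Fin n)) (p : Fin n) :
    hammingDist ⇑σ ⇑τ < hammingDist ⇑(extPerm σ p) ⇑(extFix τ) := by
  rw [hammingDist_castSucc_add]
  simp only [extPerm_castSucc, extPerm_last, extFix_castSucc, extFix_last]
  rw [if_pos (Fin.castSucc_ne_last _), Nat.lt_add_one_iff]
  refine Finset.card_le_card ?_
  intro x hx
  simp only [Finset.mem_filter, Finset.mem_univ, true_and] at hx ⊢
  have h₂ := Fin.castSucc_ne_last (τ x)
  have h₃ := Fin.castSucc_injective n (a₁ := σ x) (a₂ := τ x)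
  grind

theorem mem_extSet {n s d : ℕ} {Ps : PartitionSystem n s d} {π : Equiv.Perm (Fin (n + 1))} :
    π ∈ extSet Ps ↔
      (∃ i, ∃ σ ∈ Ps.M i.castSucc, (∃ p ∈ Ps.P i, σ p ∈ Ps.Q i) ∧
        extPerm σ (Ps.choice i σ) = π) ∨
      ∃ σ ∈ Ps.M (Fin.last s), extFix σ = π := by
  simp [extSet, and_assoc]

/-- Partition and extension: the extended array of a distance-`d` partition system has
Hamming distance at least `d`. -/
theorem le_hammingDist_of_mem_extSet {n s d : ℕ} (Ps : PartitionSystem n s d)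
    {σ' τ' : Equiv.Perm (Fin (n + 1))} (hσ' : σ' ∈ extSet Ps) (hτ' : τ' ∈ extSet Ps)
    (hne : σ' ≠ τ') : d ≤ hammingDist ⇑σ' ⇑τ' := by
  rw [mem_extSet] at hσ' hτ'
  rcases hσ' with ⟨i, σ, hσ, hcσ, rfl⟩ | ⟨σ, hσ, rfl⟩ <;>
    rcases hτ' with ⟨j, τ, hτ, hcτ, rfl⟩ | ⟨τ, hτ, rfl⟩
  · by_cases hij : i = j
    · subst hij
      refine (Ps.hd_intra _ σ hσ τ hτ ?_).trans (hammingDist_le_extPerm _ _ _ _)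
      rintro rfl
      exact hne rfl
    · obtain ⟨hpσ, hqσ⟩ := Ps.choice_spec i σ hcσ
      obtain ⟨hpτ, hqτ⟩ := Ps.choice_spec j τ hcτ
      have h := hammingDist_lt_extPerm σ τ (p := Ps.choice i σ) (q := Ps.choice j τ)
        (fun e => Finset.disjoint_left.mp (Ps.P_disjoint i j hij) hpσ (e ▸ hpτ))
        (fun e => Finset.disjoint_left.mp (Ps.Q_disjoint i j hij) hqσ (e ▸ hqτ))
      have h' := Ps.hd_inter _ _ (fun e => hij (Fin.castSucc_injective s e)) σ hσ τ hτ
      omega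
  · have h := hammingDist_lt_extPerm_extFix σ τ (Ps.choice i σ)
    have h' := Ps.hd_inter _ _ (Fin.castSucc_ne_last i) σ hσ τ hτ
    omega
  · have h := hammingDist_lt_extPerm_extFix τ σ (Ps.choice j τ)
    have h' := Ps.hd_inter _ _ (Fin.castSucc_ne_last j) τ hτ σ hσ
    rw [hammingDist_comm]
    omega
  · rw [hammingDist_extFix]
    refine Ps.hd_intra _ σ hσ τ hτ ?_
    rintro rfl
    exact hne rfl

/-- **Theorem (sequential partition and extension).** Let `d ≥ 2` and `m = t+1 > 1`, and let
`Π₁, …, Π_m` be pairwise disjoint distance-`d` partition systems for `Z_n` with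
`hd(Mⁱ, Mʲ) ≥ d−1` for `i ≠ j`. If `Ψ` is a distance-`d` partition system for `Z_{n+1}`
whose list of permutation sets is `(ext(Π₁), …, ext(Π_m))` (with `ext(Π_m)` as the last,
unpartitioned set), then `ext(Ψ)` is a set of permutations of `Z_{n+2}` with
`hd(ext(Ψ)) ≥ d`. -/
theorem sequential_partition_and_extension {n t d : ℕ} (hd2 : 2 ≤ d) (ht : 0 < t)
    (s : Fin (t + 1) → ℕ) (Ps : ∀ i : Fin (t + 1), PartitionSystem n (s i) d)
    (hdisj : ∀ i j, i ≠ j → ∀ a b, Disjoint ((Ps i).M a) ((Ps j).M b))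
    (hcross : ∀ i j, i ≠ j → ∀ a b, ∀ σ ∈ (Ps i).M a, ∀ τ ∈ (Ps j).M b,
      d - 1 ≤ hammingDist ⇑σ ⇑τ)
    (Psi : PartitionSystem (n + 1) t d)
    (hPsi : ∀ i : Fin (t + 1), Psi.M i = extSet (Ps i)) :
    ∀ σ' ∈ extSet Psi, ∀ τ' ∈ extSet Psi, σ' ≠ τ' → d ≤ hammingDist ⇑σ' ⇑τ' := by
  exact fun _ hσ _ hτ hne => le_hammingDist_of_mem_extSet Psi hσ hτ hne
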